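/- A graph is a normal Helly circular-arc (NHCA) graph if and only if it admits a locally out-straight orientation. -/

import Mathlib

open Set

noncomputable section

instance : Fact ((0:ℝ) < 1) := ⟨one_pos⟩

/-- A point on the circle (of circumference 1). -/
abbrev Circ : Type := AddCircle (1 : ℝ)

/-- An arc of the circle, described by its beginning point `s` and its ending point `t`
(the arc is traversed clockwise, i.e. in the positive circular direction, from `s` to `t`). -/
structure Arc where
  s : Circ
  t : Circ

/-- The set of points of the open arc: the points strictly between `s` and `t`
in the circular order. -/
def Arc.pts (A : Arc) : Set Circ := {x | sbtw A.s x A.t}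

/-- The length of an arc: the representative in `(0, 1]` of `t - s`. -/
def Arc.length (A : Arc) : ℝ := ((AddCircle.equivIoc (1:ℝ) 0) (A.t - A.s) : ℝ)

/-- A circular-arc (CA) model: a finite family of arcs of the circle such that all
endpoints of the arcs are pairwise distinct (in particular each arc has two distinct
endpoints, hence no arc covers the whole circle). -/
structure CAModel (V : Type) [Fintype V] where
  arc : V → Arc
  endpoints_distinct : Function.Injective
    (fun p : V × Bool => if p.2 then (arc p.1).s else (arc p.1).t)

namespace CAModel

variable {V : Type} [Fintype V]

/-- The arcs of `u` and `v` intersect. -/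
def Inter (M : CAModel V) (u v : V) : Prop := ((M.arc u).pts ∩ (M.arc v).pts).Nonempty

/-- The intersection graph of the model: two distinct arcs are adjacent iff they have
nonempty intersection. -/
def interGraph (M : CAModel V) : SimpleGraph V :=
  SimpleGraph.fromRel fun u v => M.Inter u v

/-- `M` is a model of the graph `G`: the arcs are in correspondence with the vertices of `G`
and two vertices are adjacent iff their arcs are distinct and intersect. -/
def IsModelOf (M : CAModel V) (G : SimpleGraph V) : Prop :=
  ∀ u v, G.Adj u v ↔ u ≠ v ∧ M.Inter u v

/-- Helly model: every subfamily of pairwise intersecting arcs has a common point. -/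
def Helly (M : CAModel V) : Prop :=
  ∀ S : Set V, (∀ u ∈ S, ∀ v ∈ S, M.Inter u v) → ∃ p : Circ, ∀ v ∈ S, p ∈ (M.arc v).pts

/-- Normal model: no two arcs together cover the whole circle. -/
def Normal (M : CAModel V) : Prop :=
  ∀ u v : V, u ≠ v → (M.arc u).pts ∪ (M.arc v).pts ≠ Set.univ

/-- No three arcs together cover the whole circle. -/
def NoThreeCover (M : CAModel V) : Prop :=
  ∀ u v w : V, u ≠ v → u ≠ w → v ≠ w →
    (M.arc u).pts ∪ (M.arc v).pts ∪ (M.arc w).pts ≠ Set.univ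

/-- Proper model: no arc is properly contained in another arc. -/
def Proper (M : CAModel V) : Prop :=
  ∀ u v : V, u ≠ v → ¬ (M.arc u).pts ⊂ (M.arc v).pts

/-- Unit model: all arcs have the same length. -/
def IsUnit (M : CAModel V) : Prop :=
  ∀ u v : V, (M.arc u).length = (M.arc v).length

/-- Interval model: some point of the circle is covered by no arc. -/
def IsIntervalModel (M : CAModel V) : Prop :=
  ∃ p : Circ, ∀ v : V, p ∉ (M.arc v).pts

/-- A universal arc: it intersects every other arc of the model. -/
def UniversalArc (M : CAModel V) (v : V) : Prop :=
  ∀ w, w ≠ v → M.Inter v w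

end CAModel

section GraphClasses

variable {V : Type} [Fintype V]

def IsCAGraph (G : SimpleGraph V) : Prop := ∃ M : CAModel V, M.IsModelOf G
def IsHCAGraph (G : SimpleGraph V) : Prop := ∃ M : CAModel V, M.Helly ∧ M.IsModelOf G
def IsNCAGraph (G : SimpleGraph V) : Prop := ∃ M : CAModel V, M.Normal ∧ M.IsModelOf G
def IsNHCAGraph (G : SimpleGraph V) : Prop :=
  ∃ M : CAModel V, M.Normal ∧ M.Helly ∧ M.IsModelOf G
def IsPCAGraph (G : SimpleGraph V) : Prop := ∃ M : CAModel V, M.Proper ∧ M.IsModelOf G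
def IsNPCAGraph (G : SimpleGraph V) : Prop :=
  ∃ M : CAModel V, M.Normal ∧ M.Proper ∧ M.IsModelOf G
def IsPHCAGraph (G : SimpleGraph V) : Prop :=
  ∃ M : CAModel V, M.Proper ∧ M.Helly ∧ M.IsModelOf G
def IsUCAGraph (G : SimpleGraph V) : Prop := ∃ M : CAModel V, M.IsUnit ∧ M.IsModelOf G
def IsUHCAGraph (G : SimpleGraph V) : Prop :=
  ∃ M : CAModel V, M.IsUnit ∧ M.Helly ∧ M.IsModelOf G
def IsIntervalGraph (G : SimpleGraph V) : Prop :=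
  ∃ M : CAModel V, M.IsIntervalModel ∧ M.IsModelOf G

end GraphClasses
/-! ### GraphOrientations and round / straight enumerations -/

/-- An orientation of a graph `G`: each edge of `G` receives exactly one direction. -/
structure GraphOrientation {V : Type} (G : SimpleGraph V) where
  dir : V → V → Prop
  dir_adj : ∀ u v, dir u v → G.Adj u v
  adj_dir : ∀ u v, G.Adj u v → (dir u v ↔ ¬ dir v u)

namespace GraphOrientation

variable {V : Type} [Fintype V] {G : SimpleGraph V}

/-- The out-degree `d⁺(v)` of a vertex. -/
def outDeg (D : GraphOrientation G) (v : V) : ℕ := {w | D.dir v w}.ncard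

/-- The in-degree `d⁻(v)` of a vertex. -/
def inDeg (D : GraphOrientation G) (v : V) : ℕ := {w | D.dir w v}.ncard

end GraphOrientation

/-- The clockwise (forward) circular distance from position `i` to position `j`
among `n` circular positions. -/
def cdist (n : ℕ) (i j : Fin n) : ℕ := ((j : ℕ) + n - (i : ℕ)) % n

variable {V : Type} [Fintype V] {G : SimpleGraph V}

/-- `σ` is an out-round enumeration of `D`: for every `i`,
`N⁺[v_i] = {v_i, v_{i+1}, …, v_{i+d⁺(v_i)}}`, indices modulo `n`; equivalently,
`v_j ∈ N⁺[v_i]` iff the clockwise distance from `i` to `j` is at most `d⁺(v_i)`. -/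
def IsOutRoundEnum (D : GraphOrientation G) (σ : Fin (Fintype.card V) ≃ V) : Prop :=
  ∀ i j : Fin (Fintype.card V),
    (σ j = σ i ∨ D.dir (σ i) (σ j)) ↔
      cdist (Fintype.card V) i j ≤ D.outDeg (σ i)

/-- `σ` is a round enumeration of `D`: additionally to the out-round condition,
`N⁻[v_i] = {v_{i-d⁻(v_i)}, …, v_i}`, indices modulo `n`. -/
def IsRoundEnum (D : GraphOrientation G) (σ : Fin (Fintype.card V) ≃ V) : Prop :=
  ∀ i j : Fin (Fintype.card V),
    ((σ j = σ i ∨ D.dir (σ i) (σ j)) ↔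
      cdist (Fintype.card V) i j ≤ D.outDeg (σ i)) ∧
    ((σ j = σ i ∨ D.dir (σ j) (σ i)) ↔
      cdist (Fintype.card V) j i ≤ D.inDeg (σ i))

/-- Position `l` holds the leftmost neighbor of `v_i`: `v_l ∈ N⁻[v_i]` and `v_l` is the
member of `N⁻[v_i]` reached last when traversing the enumeration backwards from `v_i`. -/
def IsLeftmostPos (D : GraphOrientation G) (σ : Fin (Fintype.card V) ≃ V)
    (i l : Fin (Fintype.card V)) : Prop :=
  (σ l = σ i ∨ D.dir (σ l) (σ i)) ∧
  ∀ l' : Fin (Fintype.card V), (σ l' = σ i ∨ D.dir (σ l') (σ i)) →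
    cdist (Fintype.card V) l' i ≤ cdist (Fintype.card V) l i

/-- Position `r` holds the rightmost neighbor of `v_i`: `v_r ∈ N⁺[v_i]` and `v_r` is the
member of `N⁺[v_i]` reached last when traversing the enumeration forwards from `v_i`. -/
def IsRightmostPos (D : GraphOrientation G) (σ : Fin (Fintype.card V) ≃ V)
    (i r : Fin (Fintype.card V)) : Prop :=
  (σ r = σ i ∨ D.dir (σ i) (σ r)) ∧
  ∀ r' : Fin (Fintype.card V), (σ r' = σ i ∨ D.dir (σ i) (σ r')) →
    cdist (Fintype.card V) i r' ≤ cdist (Fintype.card V) i r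

/-- The out-degree of `v_j` inside the scope `Cir[v_l, v_r]` (the subdigraph induced by
the positions in the circular range from `l` to `r`). -/
def scopeOutDeg (D : GraphOrientation G) (σ : Fin (Fintype.card V) ≃ V)
    (l r j : Fin (Fintype.card V)) : ℕ :=
  {k : Fin (Fintype.card V) |
    cdist (Fintype.card V) l k ≤ cdist (Fintype.card V) l r ∧ D.dir (σ j) (σ k)}.ncard

/-- The in-degree of `v_j` inside the scope `Cir[v_l, v_r]`. -/
def scopeInDeg (D : GraphOrientation G) (σ : Fin (Fintype.card V) ≃ V)
    (l r j : Fin (Fintype.card V)) : ℕ :=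
  {k : Fin (Fintype.card V) |
    cdist (Fintype.card V) l k ≤ cdist (Fintype.card V) l r ∧ D.dir (σ k) (σ j)}.ncard

/-- `σ` is a locally out-straight enumeration: it is out-round and, for every vertex
`v_i`, its scope `Cir[v_l, v_r]` (where `v_l`, `v_r` are the leftmost and rightmost
neighbors of `v_i`), in the order induced by `σ` (position within the scope being the
clockwise distance from `l`), is an out-straight enumeration of the induced subdigraph:
for `v_j, v_k` in the scope, `v_k ∈ N⁺[v_j]` (within the scope) iff the position of `v_k`
lies in the linear range from the position of `v_j` to the position of `v_j` plus the
out-degree of `v_j` in the subdigraph. -/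
def IsLocallyOutStraightEnum (D : GraphOrientation G) (σ : Fin (Fintype.card V) ≃ V) : Prop :=
  IsOutRoundEnum D σ ∧
  ∀ i l r : Fin (Fintype.card V),
    IsLeftmostPos D σ i l → IsRightmostPos D σ i r →
    ∀ j k : Fin (Fintype.card V),
      cdist (Fintype.card V) l j ≤ cdist (Fintype.card V) l r →
      cdist (Fintype.card V) l k ≤ cdist (Fintype.card V) l r →
      ((σ k = σ j ∨ D.dir (σ j) (σ k)) ↔
        (cdist (Fintype.card V) l j ≤ cdist (Fintype.card V) l k ∧
         cdist (Fintype.card V) l k ≤ cdist (Fintype.card V) l j + scopeOutDeg D σ l r j))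

/-- `σ` is a locally straight enumeration: it is round and, for every vertex `v_i`, its
scope `Cir[v_l, v_r]`, in the order induced by `σ`, is a straight enumeration of the
induced subdigraph: for `v_j, v_k` in the scope, `v_k ∈ N⁺[v_j]` (within the scope) iff
the position of `v_k` lies in the linear range from `v_j` forwards of length the
out-degree of `v_j` in the subdigraph, and `v_k ∈ N⁻[v_j]` (within the scope) iff the
position of `v_k` lies in the linear range ending at `v_j` of length the in-degree of
`v_j` in the subdigraph. -/
def IsLocallyStraightEnum (D : GraphOrientation G) (σ : Fin (Fintype.card V) ≃ V) : Prop :=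
  IsRoundEnum D σ ∧
  ∀ i l r : Fin (Fintype.card V),
    IsLeftmostPos D σ i l → IsRightmostPos D σ i r →
    ∀ j k : Fin (Fintype.card V),
      cdist (Fintype.card V) l j ≤ cdist (Fintype.card V) l r →
      cdist (Fintype.card V) l k ≤ cdist (Fintype.card V) l r →
      (((σ k = σ j ∨ D.dir (σ j) (σ k)) ↔
        (cdist (Fintype.card V) l j ≤ cdist (Fintype.card V) l k ∧
         cdist (Fintype.card V) l k ≤ cdist (Fintype.card V) l j + scopeOutDeg D σ l r j)) ∧
       ((σ k = σ j ∨ D.dir (σ k) (σ j)) ↔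
        (cdist (Fintype.card V) l k ≤ cdist (Fintype.card V) l j ∧
         cdist (Fintype.card V) l j ≤ cdist (Fintype.card V) l k + scopeInDeg D σ l r j)))

/-! Forward distance on the circle. -/
def fd (a b : Circ) : ℝ := (AddCircle.equivIco (1:ℝ) 0 (b - a) : ℝ)

lemma fd_nonneg (a b : Circ) : 0 ≤ fd a b := (AddCircle.equivIco (1:ℝ) 0 (b - a)).2.1

lemma fd_lt_one (a b : Circ) : fd a b < 1 := by
  have := (AddCircle.equivIco (1:ℝ) 0 (b - a)).2.2
  simpa [fd] using this

lemma add_fd (a b : Circ) : a + (fd a b : Circ) = b := by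
  have : ((fd a b : ℝ) : Circ) = b - a := AddCircle.coe_equivIco (p := (1:ℝ)) (a := 0)
  rw [this]; abel

lemma fd_add (a : Circ) (L : ℝ) (h0 : 0 ≤ L) (h1 : L < 1) : fd a (a + (L : Circ)) = L := by
  unfold fd
  rw [add_sub_cancel_left, AddCircle.equivIco_coe_of_mem]
  constructor <;> simp [h0, h1]

lemma fd_self (a : Circ) : fd a a = 0 := by
  have := fd_add a 0 le_rfl one_pos
  simpa using this

lemma eq_of_fd {a b : Circ} (h : fd a b = 0) : a = b := by
  have := add_fd a b
  rw [h] at this; simpa using this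

lemma fd_pos {a b : Circ} (h : a ≠ b) : 0 < fd a b :=
  lt_of_le_of_ne (fd_nonneg a b) (fun e => h (eq_of_fd e.symm))

lemma coe_add_one (x : ℝ) : ((x + 1 : ℝ) : Circ) = x := by
  rw [AddCircle.coe_add, AddCircle.coe_period, add_zero]

lemma fd_coc (a b c : Circ) : fd a b + fd b c = fd a c ∨ fd a b + fd b c = fd a c + 1 := by
  have h0 := fd_nonneg a b
  have h1 := fd_nonneg b c
  have h2 := fd_lt_one a b
  have h3 := fd_lt_one b c
  have e : a + ((fd a b + fd b c : ℝ) : Circ) = c := by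
    rw [AddCircle.coe_add, ← add_assoc, add_fd, add_fd]
  by_cases h : fd a b + fd b c < 1
  · left
    rw [← fd_add a _ (by linarith) h, e]
  · right
    have e' : a + ((fd a b + fd b c - 1 : ℝ) : Circ) = c := by
      have := coe_add_one (fd a b + fd b c - 1)
      rw [sub_add_cancel] at this
      rw [← this]; exact e
    have := fd_add a (fd a b + fd b c - 1) (by linarith) (by linarith)
    rw [e'] at this
    linarith

lemma fd_cases (a b : Circ) : fd a b = fd 0 b - fd 0 a ∨ fd a b = fd 0 b - fd 0 a + 1 := by
  rcases fd_coc 0 a b with h | h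
  · left; linarith
  · right; linarith

lemma sbtw_iff_fd (a x b : Circ) : sbtw a x b ↔ 0 < fd a x ∧ fd a x < fd a b := by
  rw [sbtw_iff_not_btw, btw_cyclic]
  change ¬ ((fd a b) ≤ ((AddCircle.equivIoc (1:ℝ) 0 (x - a) : _) : ℝ)) ↔ _
  rw [not_le]
  by_cases h : a = x
  · subst h
    have : ((AddCircle.equivIoc (1:ℝ) 0 (a - a) : _) : ℝ) = 1 := by
      rw [sub_self]
      rw [← AddCircle.coe_period (1:ℝ), AddCircle.equivIoc_coe_of_mem]
      simp
    rw [this, fd_self]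
    have := fd_lt_one a b
    constructor
    · intro h; linarith
    · intro h; linarith [h.1]
  · have hp := fd_pos h
    have : ((AddCircle.equivIoc (1:ℝ) 0 (x - a) : _) : ℝ) = fd a x := by
      have e : x - a = (fd a x : Circ) := by rw [sub_eq_iff_eq_add, add_comm, add_fd]
      conv_lhs => rw [e]
      rw [AddCircle.equivIoc_coe_of_mem]
      exact ⟨hp, by linarith [fd_lt_one a x]⟩
    rw [this]; simp [hp]

lemma mem_pts (A : Arc) (x : Circ) : x ∈ A.pts ↔ 0 < fd A.s x ∧ fd A.s x < fd A.s A.t :=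
  sbtw_iff_fd _ _ _

lemma start_notMem (A : Arc) : A.s ∉ A.pts := by
  rw [mem_pts, fd_self]; simp

lemma inter_start {A B : Arc} (h : (A.pts ∩ B.pts).Nonempty) (hne : A.s ≠ B.s) :
    B.s ∈ A.pts ∨ A.s ∈ B.pts := by
  obtain ⟨p, h1, h2⟩ := h
  simp only [mem_pts] at *
  have a1 := fd_pos hne
  have a2 := fd_pos hne.symm
  have a3 := fd_lt_one A.s B.s
  have a4 := fd_lt_one B.s A.s
  rcases fd_coc A.s B.s p with h | h <;> rcases fd_coc B.s A.s p with h' | h'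
  · exfalso; linarith
  · left; exact ⟨a1, by linarith⟩
  · right; exact ⟨a2, by linarith⟩
  · exfalso; linarith [fd_lt_one A.s p, fd_lt_one B.s p]

lemma start_inter {A B : Arc} (h : B.s ∈ A.pts) (hB : B.s ≠ B.t) : (A.pts ∩ B.pts).Nonempty := by
  rw [mem_pts] at h
  have hb := fd_pos hB
  have hb1 := fd_lt_one B.s B.t
  have ha1 := fd_lt_one A.s A.t
  obtain ⟨d, hd, hd'⟩ := exists_between
    (show (0:ℝ) < min (fd B.s B.t) (fd A.s A.t - fd A.s B.s) from lt_min hb (by linarith [h.2]))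
  rw [lt_min_iff] at hd'
  have e := fd_add B.s d hd.le (by linarith)
  refine ⟨B.s + (d : Circ), ?_, ?_⟩
  · rw [mem_pts]
    have := fd_coc A.s B.s (B.s + (d : Circ))
    have := fd_nonneg A.s (B.s + (d : Circ))
    rcases fd_coc A.s B.s (B.s + (d : Circ)) with h | h
    · constructor <;> linarith
    · linarith
  · rw [mem_pts, e]; exact ⟨hd, hd'.1⟩

lemma cover_of_starts {A B : Arc} (h1 : B.s ∈ A.pts) (h2 : A.s ∈ B.pts) :
    A.pts ∪ B.pts = Set.univ := by
  ext p
  simp only [Set.mem_union, Set.mem_univ, iff_true]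
  by_contra! hc
  by_cases e : p = A.s
  · subst e; exact hc.2 h2
  by_cases e' : p = B.s
  · subst e'; exact hc.1 h1
  simp only [mem_pts] at *
  have p1 := fd_pos (Ne.symm e)
  have p2 := fd_pos (Ne.symm e')
  have c1 : fd A.s A.t ≤ fd A.s p := by by_contra! hh; exact hc.1 ⟨p1, hh⟩
  have c2 : fd B.s B.t ≤ fd B.s p := by by_contra! hh; exact hc.2 ⟨p2, hh⟩
  have := fd_lt_one A.s p
  have := fd_lt_one B.s p
  rcases fd_coc A.s B.s p with h | h <;> rcases fd_coc B.s A.s p with h' | h' <;>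
  linarith

lemma starts_of_cover {A B : Arc} (h : A.pts ∪ B.pts = Set.univ) :
    B.s ∈ A.pts ∧ A.s ∈ B.pts := by
  constructor
  · have : B.s ∈ A.pts ∪ B.pts := by rw [h]; trivial
    exact this.resolve_right (start_notMem B)
  · have : A.s ∈ A.pts ∪ B.pts := by rw [h]; trivial
    exact this.resolve_left (start_notMem A)

/-- No common point for a cyclic triple. -/
lemma no_common {A B C : Arc} (h1 : B.s ∈ A.pts) (h2 : C.s ∈ B.pts) (h3 : A.s ∈ C.pts)
    (h1' : A.s ∉ B.pts) (h2' : B.s ∉ C.pts) (h3' : C.s ∉ A.pts) {p : Circ}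
    (hA : p ∈ A.pts) (hB : p ∈ B.pts) (hC : p ∈ C.pts) : False := by
  have nAB : A.s ≠ B.s := fun e => start_notMem A (e ▸ h1)
  have nBC : B.s ≠ C.s := fun e => start_notMem B (e ▸ h2)
  have nCA : C.s ≠ A.s := fun e => start_notMem C (e ▸ h3)
  simp only [mem_pts] at *
  have k1 : fd B.s B.t ≤ fd B.s A.s := by by_contra! hh; exact h1' ⟨fd_pos nAB.symm, hh⟩
  have k2 : fd C.s C.t ≤ fd C.s B.s := by by_contra! hh; exact h2' ⟨fd_pos nBC.symm, hh⟩
  have k3 : fd A.s A.t ≤ fd A.s C.s := by by_contra! hh; exact h3' ⟨fd_pos nCA.symm, hh⟩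
  rcases fd_coc A.s B.s C.s with h | h <;> rcases fd_coc A.s B.s p with h' | h' <;>
  rcases fd_coc B.s C.s p with h'' | h'' <;> rcases fd_coc C.s A.s p with h4 | h4 <;>
  rcases fd_coc B.s C.s A.s with h5 | h5 <;> rcases fd_coc C.s A.s B.s with h6 | h6 <;>
  linarith [fd_lt_one A.s p, fd_lt_one B.s p, fd_lt_one C.s p, fd_lt_one A.s C.s,
    fd_lt_one B.s A.s, fd_lt_one C.s B.s]

/-! Combinatorics of `cdist`. -/

lemma cdist_eq {n : ℕ} (i j : Fin n) :
    cdist n i j = if (i : ℕ) ≤ j then (j : ℕ) - i else (j : ℕ) + n - i := by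
  have hi := i.2
  have hj := j.2
  unfold cdist
  split_ifs with h
  · have : (j : ℕ) + n - i = (j - i) + n := by omega
    rw [this, Nat.add_mod_right, Nat.mod_eq_of_lt (by omega)]
  · rw [Nat.mod_eq_of_lt (by omega)]

lemma cdist_lt {n : ℕ} (i j : Fin n) : cdist n i j < n := by
  have hi := i.2
  have hj := j.2
  rw [cdist_eq]; split_ifs <;> omega

lemma cdist_coc {n : ℕ} (i j k : Fin n) :
    cdist n i j + cdist n j k = cdist n i k ∨ cdist n i j + cdist n j k = cdist n i k + n := by
  have hi := i.2
  have hj := j.2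
  have hk := k.2
  simp only [cdist_eq]
  split_ifs <;> omega

lemma cdist_self {n : ℕ} (i : Fin n) : cdist n i i = 0 := by
  rw [cdist_eq]; simp

lemma eq_of_cdist {n : ℕ} {i j : Fin n} (h : cdist n i j = 0) : i = j := by
  have hi := i.2
  have hj := j.2
  rw [cdist_eq] at h
  ext
  split_ifs at h <;> omega

lemma cdist_pos {n : ℕ} {i j : Fin n} (h : i ≠ j) : 0 < cdist n i j :=
  Nat.pos_of_ne_zero fun e => h (eq_of_cdist e)

lemma cdist_inj {n : ℕ} (l : Fin n) : Function.Injective (cdist n l) := by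
  intro i j h
  have hi := i.2
  have hj := j.2
  have hl := l.2
  simp only [cdist_eq] at h
  ext
  split_ifs at h <;> omega

lemma cdist_surj {n : ℕ} (l : Fin n) (m : ℕ) (hm : m < n) : ∃ k, cdist n l k = m := by
  have hl := l.2
  by_cases h : l + m < n
  · refine ⟨⟨l + m, h⟩, ?_⟩
    rw [cdist_eq]; simp
  · refine ⟨⟨l + m - n, by omega⟩, ?_⟩
    rw [cdist_eq]; simp only
    split_ifs <;> omega

/-- A contiguous range of positions is determined by its cardinality. -/
lemma range_card {n : ℕ} (l : Fin n) (a : ℕ) (Q : Fin n → Prop)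
    (h1 : ∀ k, Q k → a < cdist n l k)
    (h2 : ∀ k k', Q k → a < cdist n l k' → cdist n l k' ≤ cdist n l k → Q k') (k : Fin n) :
    (a < cdist n l k ∧ cdist n l k ≤ a + {k | Q k}.ncard) ↔ Q k := by
  classical
  have key : ∃ b, Set.image (cdist n l) {k | Q k} = Set.Ioc a b := by
    by_cases hne : ({k | Q k} : Set (Fin n)).Nonempty
    · obtain ⟨m, hm, hmax⟩ := Set.exists_max_image {k | Q k} (cdist n l) (Set.toFinite _) hne
      refine ⟨cdist n l m, ?_⟩
      ext x
      constructor
      · rintro ⟨k, hk, rfl⟩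
        exact ⟨h1 k hk, hmax k hk⟩
      · rintro ⟨hx1, hx2⟩
        obtain ⟨k, rfl⟩ := cdist_surj l x (lt_of_le_of_lt hx2 (cdist_lt _ _))
        exact ⟨k, h2 m k hm hx1 hx2, rfl⟩
    · refine ⟨a, ?_⟩
      rw [Set.not_nonempty_iff_eq_empty.mp hne]; simp
  obtain ⟨b, hb⟩ := key
  have hc : ({k | Q k} : Set (Fin n)).ncard = b - a := by
    rw [← Set.ncard_image_of_injective _ (cdist_inj l), hb, ← Finset.coe_Ioc,
      Set.ncard_coe_finset, Nat.card_Ioc]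
  have hq : Q k ↔ cdist n l k ∈ Set.Ioc a b := by
    rw [← hb]
    constructor
    · intro h; exact ⟨k, h, rfl⟩
    · rintro ⟨k', h, e⟩
      rw [← cdist_inj l e]; exact h
  rw [hc, hq, Set.mem_Ioc]
  constructor <;> rintro ⟨h, h'⟩ <;> refine ⟨h, ?_⟩ <;> omega

section
variable {V : Type} [Fintype V] {G : SimpleGraph V}

lemma dir_ne (D : GraphOrientation G) {u v : V} (h : D.dir u v) : u ≠ v :=
  (D.dir_adj u v h).ne

lemma dir_asymm (D : GraphOrientation G) {u v : V} (h : D.dir u v) : ¬ D.dir v u :=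
  (D.adj_dir u v (D.dir_adj u v h)).mp h

/-- Out-neighborhoods are circular ranges starting right after the vertex. -/
def OutClosed (D : GraphOrientation G) (σ : Fin (Fintype.card V) ≃ V) : Prop :=
  ∀ i j k, D.dir (σ i) (σ j) → i ≠ k →
    cdist (Fintype.card V) i k ≤ cdist (Fintype.card V) i j → D.dir (σ i) (σ k)

def NoTri (D : GraphOrientation G) : Prop :=
  ∀ u v w, D.dir u v → D.dir v w → ¬ D.dir w u

lemma outClosed_of_round {D : GraphOrientation G} {σ : Fin (Fintype.card V) ≃ V}
    (h : IsOutRoundEnum D σ) : OutClosed D σ := by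
  intro i j k hij hik hle
  rcases (h i k).mpr (hle.trans ((h i j).mp (Or.inr hij))) with e | e
  · exact absurd (σ.injective e).symm hik
  · exact e

lemma round_of_outClosed {D : GraphOrientation G} {σ : Fin (Fintype.card V) ≃ V}
    (h : OutClosed D σ) : IsOutRoundEnum D σ := by
  intro i j
  have key := range_card i 0 (fun k => D.dir (σ i) (σ k))
    (fun k hk => cdist_pos fun e => dir_ne D hk (by rw [e]))
    (fun k k' hk hk' hle => h i k k' hk (by rintro rfl; rw [cdist_self] at hk'; omega) hle) j
  have hc : ({k | D.dir (σ i) (σ k)} : Set (Fin (Fintype.card V))).ncard = D.outDeg (σ i) := by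
    unfold GraphOrientation.outDeg
    rw [← Set.ncard_image_of_injective _ σ.injective]
    congr 1
    ext w
    constructor
    · rintro ⟨k, hk, rfl⟩; exact hk
    · intro hw; exact ⟨σ.symm w, by simpa using hw, by simp⟩
  rw [hc, zero_add] at key
  rw [← key]
  constructor
  · rintro (e | e)
    · rw [σ.injective e, cdist_self]; omega
    · exact e.2
  · intro hle
    by_cases e : i = j
    · left; rw [e]
    · right; exact ⟨cdist_pos e, hle⟩

lemma straight_of {D : GraphOrientation G} {σ : Fin (Fintype.card V) ≃ V}
    (h : OutClosed D σ) (ht : NoTri D) : IsLocallyOutStraightEnum D σ := by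
  refine ⟨round_of_outClosed h, ?_⟩
  intro i l r hl hr j k hj hk
  have main : ∀ k, cdist (Fintype.card V) l k ≤ cdist (Fintype.card V) l r → D.dir (σ j) (σ k) → cdist (Fintype.card V) l j < cdist (Fintype.card V) l k := by
    intro k hk hjk
    by_contra! hlt
    have hjk' : j ≠ k := fun e => dir_ne D hjk (by rw [e])
    have hlt' : cdist (Fintype.card V) l k < cdist (Fintype.card V) l j :=
      lt_of_le_of_ne hlt fun e => hjk' (cdist_inj l e).symm
    have hjl : j ≠ l := by rintro rfl; rw [cdist_self] at hlt'; omega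
    have h1 := cdist_pos hjl
    have h2 := cdist_pos hjk'
    have jl : D.dir (σ j) (σ l) := by
      refine h j k l hjk hjl ?_
      have c1 := cdist_coc l j k
      have c2 := cdist_coc l j l
      rw [cdist_self] at c2
      have := cdist_lt j k
      have := cdist_lt j l
      omega
    by_cases hc : cdist (Fintype.card V) l j ≤ cdist (Fintype.card V) l i
    · have hli : l ≠ i := by rintro rfl; rw [cdist_self] at hc; omega
      have li : D.dir (σ l) (σ i) := by
        rcases hl.1 with e | e
        · exact absurd (σ.injective e) hli
        · exact e
      exact dir_asymm D jl (h l i j li hjl.symm hc)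
    · push Not at hc
      have hri : r ≠ i := by rintro rfl; omega
      have hij : i ≠ j := by rintro rfl; omega
      have ir : D.dir (σ i) (σ r) := by
        rcases hr.1 with e | e
        · exact absurd (σ.injective e) hri
        · exact e
      have ij : D.dir (σ i) (σ j) := by
        refine h i r j ir hij ?_
        have c1 := cdist_coc l i j
        have c2 := cdist_coc l i r
        have := cdist_lt i j
        have := cdist_lt i r
        omega
      rcases hl.1 with e | e
      · rw [e] at jl; exact dir_asymm D jl ij
      · exact ht _ _ _ e ij jl
  have key := range_card l (cdist (Fintype.card V) l j) (fun k => cdist (Fintype.card V) l k ≤ cdist (Fintype.card V) l r ∧ D.dir (σ j) (σ k))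
    (fun k hk => main k hk.1 hk.2)
    (fun k k' hk hk' hle => ⟨hle.trans hk.1, by
      have hh := main k hk.1 hk.2
      refine h j k k' hk.2 (by rintro rfl; omega) ?_
      have c1 := cdist_coc l j k
      have c2 := cdist_coc l j k'
      have := cdist_lt j k
      have := cdist_lt j k'
      omega⟩) k
  change _ ↔ _ ∧ _ ≤ _ + ({k | cdist (Fintype.card V) l k ≤ cdist (Fintype.card V) l r ∧ D.dir (σ j) (σ k)} : Set (Fin (Fintype.card V))).ncard
  constructor
  · rintro (e | e)
    · rw [σ.injective e]; omega
    · have := key.mpr ⟨hk, e⟩; exact ⟨this.1.le, this.2⟩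
  · rintro ⟨a, b⟩
    by_cases e : j = k
    · left; rw [e]
    · right
      exact (key.mp ⟨lt_of_le_of_ne a fun e' => e (cdist_inj l e'), b⟩).2

lemma of_straight {D : GraphOrientation G} {σ : Fin (Fintype.card V) ≃ V}
    (hs : IsLocallyOutStraightEnum D σ) : OutClosed D σ ∧ NoTri D := by
  have h := outClosed_of_round hs.1
  refine ⟨h, ?_⟩
  intro u v w huv hvw hwu
  obtain ⟨i, rfl⟩ := σ.surjective u
  obtain ⟨j, rfl⟩ := σ.surjective v
  obtain ⟨k, rfl⟩ := σ.surjective w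
  obtain ⟨l, hl, hlmax⟩ := Set.exists_max_image {l | σ l = σ j ∨ D.dir (σ l) (σ j)}
    (fun l => cdist (Fintype.card V) l j) (Set.toFinite _) ⟨j, Or.inl rfl⟩
  obtain ⟨r, hr, hrmax⟩ := Set.exists_max_image {r | σ r = σ j ∨ D.dir (σ j) (σ r)}
    (fun r => cdist (Fintype.card V) j r) (Set.toFinite _) ⟨j, Or.inl rfl⟩
  have ij : i ≠ j := fun e => dir_ne D huv (by rw [e])
  have jk : j ≠ k := fun e => dir_ne D hvw (by rw [e])
  have p1 := cdist_pos ij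
  have p2 := cdist_pos jk
  have m1 : cdist (Fintype.card V) i j ≤ cdist (Fintype.card V) l j := hlmax i (Or.inr huv)
  have m2 : cdist (Fintype.card V) j k ≤ cdist (Fintype.card V) j r := hrmax k (Or.inr hvw)
  have lj : l ≠ j := by rintro rfl; rw [cdist_self] at m1; omega
  have rj : j ≠ r := by rintro rfl; rw [cdist_self] at m2; omega
  have dl : D.dir (σ l) (σ j) := hl.resolve_left fun e => lj (σ.injective e)
  have dr : D.dir (σ j) (σ r) := hr.resolve_left fun e => rj (σ.injective e).symm
  have hlt : cdist (Fintype.card V) l j + cdist (Fintype.card V) j r < Fintype.card V := by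
    by_contra! hc
    refine dir_asymm D dl (h j r l dr lj.symm ?_)
    have c := cdist_coc l j l
    rw [cdist_self] at c
    have := cdist_lt l j
    omega
  have c1 := cdist_coc l j r
  have c2 := cdist_coc l j k
  have c3 := cdist_coc l i j
  have b1 := cdist_lt l r
  have b2 := cdist_lt l k
  have b3 := cdist_lt l i
  have b4 := cdist_lt l j
  have := (hs.2 j l r ⟨hl, hlmax⟩ ⟨hr, hrmax⟩ k i (by omega) (by omega)).mp (Or.inr hwu)
  omega
end

section
variable {V : Type} [Fintype V] {G : SimpleGraph V}

lemma start_inj (M : CAModel V) {u v : V} (h : u ≠ v) : (M.arc u).s ≠ (M.arc v).s := by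
  intro e
  have := @M.endpoints_distinct (u, true) (v, true) (by simpa using e)
  simp at this; exact h this

lemma start_ne_end (M : CAModel V) (u : V) : (M.arc u).s ≠ (M.arc u).t := by
  intro e
  have := @M.endpoints_distinct (u, true) (u, false) (by simpa using e)
  simp at this

lemma inter_comm' (M : CAModel V) {u v : V} (h : M.Inter u v) : M.Inter v u := by
  unfold CAModel.Inter at *; rwa [Set.inter_comm]

lemma inter_self' (M : CAModel V) (u : V) : M.Inter u u := by
  have h := fd_pos (start_ne_end M u)
  obtain ⟨d, hd, hd'⟩ := exists_between h
  have e := fd_add (M.arc u).s d hd.le (by linarith [fd_lt_one (M.arc u).s (M.arc u).t])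
  refine ⟨(M.arc u).s + (d : Circ), ?_, ?_⟩ <;> rw [mem_pts, e] <;> exact ⟨hd, hd'⟩

lemma forward (h : IsNHCAGraph G) : ∃ (D : GraphOrientation G) (σ : Fin (Fintype.card V) ≃ V),
    OutClosed D σ ∧ NoTri D := by
  obtain ⟨M, hN, hH, hG⟩ := h
  have asym : ∀ u v, (M.arc v).s ∈ (M.arc u).pts → (M.arc u).s ∉ (M.arc v).pts := by
    intro u v h1 h2
    by_cases e : u = v
    · subst e; exact start_notMem _ h1
    · exact hN u v e (cover_of_starts h1 h2)
  have toInter : ∀ u v, (M.arc v).s ∈ (M.arc u).pts → M.Inter u v := fun u v h =>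
    start_inter h (start_ne_end M v)
  let D : GraphOrientation G :=
    { dir := fun u v => (M.arc v).s ∈ (M.arc u).pts
      dir_adj := by
        intro u v h
        rw [hG]
        exact ⟨by rintro rfl; exact start_notMem _ h, toInter u v h⟩
      adj_dir := by
        intro u v h
        rw [hG] at h
        constructor
        · exact asym u v
        · intro h'
          exact (inter_start h.2 (start_inj M h.1)).resolve_right h' }
  have xinj : Function.Injective (fun v => fd 0 (M.arc v).s) := by
    intro u v e
    by_contra hne
    apply start_inj M hne
    simp only at e
    rw [← add_fd 0 (M.arc u).s, ← add_fd 0 (M.arc v).s, e]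
  let _ : LinearOrder V := LinearOrder.lift' (fun v => fd 0 (M.arc v).s) xinj
  let τ : Fin (Fintype.card V) ≃o V := monoEquivOfFin V rfl
  have hτ : ∀ i j, i < j → fd 0 (M.arc (τ i)).s < fd 0 (M.arc (τ j)).s := by
    intro i j hij
    exact τ.strictMono hij
  refine ⟨D, τ.toEquiv, ?_, ?_⟩
  · intro i j k hij hik hle
    change (M.arc (τ k)).s ∈ (M.arc (τ i)).pts
    change (M.arc (τ j)).s ∈ (M.arc (τ i)).pts at hij
    rw [mem_pts] at *
    refine ⟨fd_pos (start_inj M fun e => hik (τ.injective e)), lt_of_le_of_lt ?_ hij.2⟩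
    by_cases hjk : j = k
    · rw [hjk]
    have hi := i.2
    have hj := j.2
    have hk := k.2
    have hik' : (i : ℕ) ≠ k := fun e => hik (Fin.ext e)
    have hjk' : (j : ℕ) ≠ k := fun e => hjk (Fin.ext e)
    have hij' : i ≠ j := by rintro rfl; rw [fd_self] at hij; linarith [hij.1]
    have hij'' : (i : ℕ) ≠ j := fun e => hij' (Fin.ext e)
    have a1 := fd_lt_one (M.arc (τ i)).s (M.arc (τ j)).s
    have a2 := fd_lt_one (M.arc (τ i)).s (M.arc (τ k)).s
    have a3 := fd_nonneg (M.arc (τ i)).s (M.arc (τ j)).s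
    have a4 := fd_nonneg (M.arc (τ i)).s (M.arc (τ k)).s
    have a5 := fd_nonneg 0 (M.arc (τ i)).s
    have a6 := fd_nonneg 0 (M.arc (τ j)).s
    have a7 := fd_nonneg 0 (M.arc (τ k)).s
    have a8 := fd_lt_one 0 (M.arc (τ i)).s
    have a9 := fd_lt_one 0 (M.arc (τ j)).s
    have a10 := fd_lt_one 0 (M.arc (τ k)).s
    rw [cdist_eq, cdist_eq] at hle
    have o1 := hτ i j
    have o2 := hτ i k
    have o3 := hτ j k
    have o1' := hτ j i
    have o2' := hτ k i
    have o3' := hτ k j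
    rw [Fin.lt_def] at o1 o2 o3 o1' o2' o3'
    rcases fd_cases (M.arc (τ i)).s (M.arc (τ j)).s with e1 | e1 <;>
    rcases fd_cases (M.arc (τ i)).s (M.arc (τ k)).s with e2 | e2 <;>
    rcases lt_or_gt_of_ne hik' with c1 | c1 <;>
    rcases lt_or_gt_of_ne hij'' with c2 | c2 <;>
    rcases lt_or_gt_of_ne hjk' with c3 | c3 <;>
    first
    | (exfalso; split_ifs at hle <;> omega)
    | (simp only [c1, c2, c3, forall_const] at o1 o2 o3 o1' o2' o3'; linarith)
  · intro u v w h1 h2 h3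
    obtain ⟨p, hp⟩ := hH {u, v, w} (by
      have i1 := toInter _ _ h1
      have i2 := toInter _ _ h2
      have i3 := toInter _ _ h3
      have j1 := inter_comm' M i1
      have j2 := inter_comm' M i2
      have j3 := inter_comm' M i3
      rintro a (rfl | rfl | rfl) b (rfl | rfl | rfl) <;>
      first | exact inter_self' M _ | assumption)
    exact no_common h1 h2 h3 (asym _ _ h1) (asym _ _ h2) (asym _ _ h3)
      (hp u (by simp)) (hp v (by simp)) (hp w (by simp))

/-- The point at position `i`. -/
def pt {n : ℕ} (i : Fin n) : Circ := (((i : ℕ) : ℝ) / n : ℝ)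

lemma pt_add {n : ℕ} (i j : Fin n) : pt i + (((cdist n i j : ℕ) / (n : ℝ) : ℝ) : Circ) = pt j := by
  have hi := i.2
  have hj := j.2
  have hn : (n : ℝ) ≠ 0 := by
    have : n ≠ 0 := by omega
    exact_mod_cast this
  unfold pt
  rw [← AddCircle.coe_add, cdist_eq]
  split_ifs with h
  · rw [Nat.cast_sub h]; congr 1; field_simp; ring
  · rw [← coe_add_one ((j : ℕ) / (n : ℝ)), Nat.cast_sub (by omega)]
    congr 1; push_cast; field_simp; ring

lemma fd_pt {n : ℕ} (i j : Fin n) : fd (pt i) (pt j) = (cdist n i j : ℕ) / (n : ℝ) := by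
  have hlt := cdist_lt i j
  have hn : (0 : ℝ) < n := by
    have : 0 < n := by omega
    exact_mod_cast this
  rw [← pt_add i j, fd_add]
  · positivity
  · rw [div_lt_one hn]; exact_mod_cast hlt

/-- The fractional offset of the end of the arc number `i`. -/
def eps {n : ℕ} (i : Fin n) : ℝ := ((i : ℕ) + 1 : ℝ) / (n + 1)

lemma eps_ge {n : ℕ} (i : Fin n) : 1 / ((n : ℝ) + 1) ≤ eps i := by
  unfold eps
  gcongr
  simp

lemma eps_lt {n : ℕ} (i : Fin n) : eps i < 1 := by
  unfold eps
  rw [div_lt_one (by positivity)]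
  have := i.2
  have : ((i : ℕ) : ℝ) < n := by exact_mod_cast this
  linarith

lemma eps_pos {n : ℕ} (i : Fin n) : 0 < eps i :=
  lt_of_lt_of_le (by positivity) (eps_ge i)

lemma eps_inj {n : ℕ} {i j : Fin n} (h : eps i = eps j) : i = j := by
  unfold eps at h
  have : ((n : ℝ) + 1) ≠ 0 := by positivity
  field_simp at h
  ext
  have : ((i : ℕ) : ℝ) = (j : ℕ) := by linarith
  exact_mod_cast this

lemma backward {D : GraphOrientation G} {σ : Fin (Fintype.card V) ≃ V}
    (h : IsOutRoundEnum D σ) (ht : NoTri D) : IsNHCAGraph G := by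
  classical
  have hcl := outClosed_of_round h

  obtain ⟨τ, hτ⟩ : ∃ τ : V ≃ Fin (Fintype.card V), ∀ v, σ (τ v) = v := ⟨σ.symm, by simp⟩
  have hdir : ∀ u v, D.dir u v ↔ u ≠ v ∧ cdist _ (τ u) (τ v) ≤ D.outDeg u := by
    intro u v
    have := h (τ u) (τ v)
    rw [hτ, hτ] at this
    constructor
    · intro hd; exact ⟨dir_ne D hd, this.mp (Or.inr hd)⟩
    · rintro ⟨hne, hle⟩; exact (this.mpr hle).resolve_left hne.symm
  have hdeg : ∀ v, D.outDeg v < Fintype.card V := by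
    intro v
    unfold GraphOrientation.outDeg
    have h1 : ({w | D.dir v w} : Set V).ncard < (Set.univ : Set V).ncard := by
      apply Set.ncard_lt_ncard _ (Set.toFinite _)
      rw [Set.ssubset_univ_iff]
      intro e
      have : v ∈ ({w | D.dir v w} : Set V) := by rw [e]; trivial
      exact dir_ne D this rfl
    rwa [Set.ncard_univ, Nat.card_eq_fintype_card] at h1
  let len : V → ℝ := fun v => ((D.outDeg v : ℝ) + eps (τ v)) / (Fintype.card V : ℝ)
  have hnpos : ∀ v : V, (0 : ℝ) < Fintype.card V := fun v => by
    exact_mod_cast Fintype.card_pos_iff.mpr ⟨v⟩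
  have len_pos : ∀ v, 0 < len v := fun v =>
    div_pos (add_pos_of_nonneg_of_pos (Nat.cast_nonneg _) (eps_pos _)) (hnpos v)
  have len_lt : ∀ v, len v < 1 := fun v => by
    rw [div_lt_one (hnpos v)]
    have h1 : (D.outDeg v : ℝ) + 1 ≤ Fintype.card V := by exact_mod_cast hdeg v
    linarith [eps_lt (τ v)]
  let A : V → Arc := fun v => ⟨pt (τ v), pt (τ v) + (len v : Circ)⟩
  have hlen : ∀ v, fd (pt (τ v)) (pt (τ v) + (len v : Circ)) = len v := fun v =>
    fd_add _ _ (len_pos v).le (len_lt v)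
  have cle : ∀ (a b : ℕ) (i : Fin (Fintype.card V)), (a : ℝ) < b + eps i ↔ a ≤ b := by
    intro a b i
    constructor
    · intro hlt
      have : (a : ℝ) < ((b + 1 : ℕ) : ℝ) := by push_cast; linarith [eps_lt i]
      have : a < b + 1 := by exact_mod_cast this
      omega
    · intro hle
      have : (a : ℝ) ≤ b := by exact_mod_cast hle
      linarith [eps_pos i]
  have hmem : ∀ u v, pt (τ v) ∈ (A u).pts ↔ D.dir u v := by
    intro u v
    rw [mem_pts, hdir]
    change 0 < fd (pt (τ u)) (pt (τ v)) ∧ fd (pt (τ u)) (pt (τ v)) <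
      fd (pt (τ u)) (pt (τ u) + (len u : Circ)) ↔ _
    rw [hlen, fd_pt, div_lt_div_iff_of_pos_right (hnpos u), cle]
    refine and_congr_left fun _ => ?_
    constructor
    · rintro hp rfl
      rw [cdist_self] at hp; simp at hp
    · intro hne
      have := cdist_pos (fun e => hne (τ.injective e))
      exact div_pos (by exact_mod_cast this) (hnpos u)
  have pt_inj : ∀ u v, pt (τ u) = pt (τ v) → u = v := by
    intro u v e
    have h1 := fd_pt (τ u) (τ v)
    rw [e, fd_self] at h1
    have h2 := (div_eq_zero_iff.mp h1.symm).resolve_right (hnpos u).ne'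
    exact τ.injective (eq_of_cdist (by exact_mod_cast h2))
  have st_ne : ∀ u v, pt (τ u) ≠ pt (τ v) + (len v : Circ) := by
    intro u v e
    have h1 := hlen v
    rw [← e, fd_pt, div_left_inj' (hnpos u).ne'] at h1
    by_cases hle : cdist (Fintype.card V) (τ v) (τ u) ≤ D.outDeg v
    · have := (cle _ _ (τ v)).mpr hle
      linarith
    · have h2 : D.outDeg v + 1 ≤ cdist (Fintype.card V) (τ v) (τ u) := by omega
      have h3 : (D.outDeg v : ℝ) + 1 ≤ (cdist (Fintype.card V) (τ v) (τ u) : ℕ) := by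
        exact_mod_cast h2
      linarith [eps_lt (τ v)]
  have end_inj : ∀ u v, pt (τ u) + (len u : Circ) = pt (τ v) + (len v : Circ) → u = v := by
    intro u v e
    have h1 := hlen u
    have h2 := hlen v
    have hn := hnpos u
    have key : ∃ m : ℤ, eps (τ u) - eps (τ v) = m := by
      have h3 := fd_coc (pt (τ v)) (pt (τ u)) (pt (τ u) + (len u : Circ))
      rw [h1, e, h2, fd_pt] at h3
      simp only [len] at h3
      rcases h3 with h3 | h3
      · refine ⟨(D.outDeg v : ℤ) - D.outDeg u - (cdist (Fintype.card V) (τ v) (τ u) : ℕ), ?_⟩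
        field_simp at h3
        push_cast
        linarith
      · refine ⟨(D.outDeg v : ℤ) - D.outDeg u - (cdist (Fintype.card V) (τ v) (τ u) : ℕ)
          + (Fintype.card V : ℕ), ?_⟩
        field_simp at h3
        push_cast
        linarith
    obtain ⟨m, hm⟩ := key
    have b1 : (m : ℝ) < (1 : ℤ) := by
      rw [← hm]; push_cast; linarith [eps_lt (τ u), eps_pos (τ v)]
    have b2 : ((-1 : ℤ) : ℝ) < m := by
      rw [← hm]; push_cast; linarith [eps_lt (τ v), eps_pos (τ u)]
    have b1' : m < 1 := by exact_mod_cast b1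
    have b2' : -1 < m := by exact_mod_cast b2
    have : m = 0 := by omega
    rw [this] at hm
    exact τ.injective (eps_inj (by push_cast at hm; linarith))
  let M : CAModel V :=
    { arc := A
      endpoints_distinct := by
        rintro ⟨u, b⟩ ⟨v, b'⟩ e
        cases b <;> cases b'
        · have e' : pt (τ u) + (len u : Circ) = pt (τ v) + (len v : Circ) := e
          rw [end_inj u v e']
        · have e' : pt (τ u) + (len u : Circ) = pt (τ v) := e
          exact absurd e'.symm (st_ne v u)
        · have e' : pt (τ u) = pt (τ v) + (len v : Circ) := e
          exact absurd e' (st_ne u v)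
        · have e' : pt (τ u) = pt (τ v) := e
          rw [pt_inj u v e'] }
  have hinter : ∀ u v, u ≠ v → M.Inter u v → D.dir u v ∨ D.dir v u := by
    intro u v hne hi
    rcases inter_start hi (start_inj M hne) with h1 | h1
    · left; exact (hmem u v).mp h1
    · right; exact (hmem v u).mp h1
  refine ⟨M, ?_, ?_, ?_⟩
  · intro u v hne hc
    obtain ⟨h1, h2⟩ := starts_of_cover hc
    exact dir_asymm D ((hmem u v).mp h1) ((hmem v u).mp h2)
  · intro S hS
    rcases S.eq_empty_or_nonempty with rfl | hne
    · exact ⟨0, by simp⟩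
    obtain ⟨z, hz, hmin⟩ := Set.exists_min_image S (fun z => {w | w ∈ S ∧ D.dir z w}.ncard)
      (Set.toFinite _) hne
    have hsink : ∀ u ∈ S, u ≠ z → D.dir u z := by
      intro u hu huz
      by_contra hnd
      have zu : D.dir z u := (hinter u z huz (hS u hu z hz)).resolve_left hnd
      have hlt : {w | w ∈ S ∧ D.dir u w}.ncard < {w | w ∈ S ∧ D.dir z w}.ncard := by
        apply Set.ncard_lt_ncard _ (Set.toFinite _)
        rw [Set.ssubset_iff_of_subset]
        · exact ⟨u, ⟨hu, zu⟩, fun hh => dir_ne D hh.2 rfl⟩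
        · rintro w ⟨hw, uw⟩
          refine ⟨hw, ?_⟩
          have hzw : z ≠ w := by rintro rfl; exact hnd uw
          exact (hinter z w hzw (hS z hz w hw)).resolve_right (ht _ _ _ zu uw)
      exact absurd (hmin u hu) (not_le.mpr hlt)
    obtain ⟨δ, hδ, hδ'⟩ := exists_between
      (show (0 : ℝ) < 1 / ((Fintype.card V : ℝ) + 1) by positivity)
    have hn := hnpos z
    have hδ1 : δ / (Fintype.card V : ℝ) < len z := by
      rw [div_lt_div_iff_of_pos_right hn]
      have := eps_ge (τ z)
      have : (0 : ℝ) ≤ D.outDeg z := Nat.cast_nonneg _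
      linarith
    have hp := fd_add (pt (τ z)) (δ / (Fintype.card V : ℝ)) (by positivity)
      (hδ1.trans (len_lt z))
    refine ⟨pt (τ z) + ((δ / (Fintype.card V : ℝ) : ℝ) : Circ), ?_⟩
    intro u hu
    have hc : cdist (Fintype.card V) (τ u) (τ z) ≤ D.outDeg u := by
      by_cases e : u = z
      · rw [e, cdist_self]; omega
      · exact ((hdir u z).mp (hsink u hu e)).2
    have hc' : ((cdist (Fintype.card V) (τ u) (τ z) : ℕ) : ℝ) ≤ D.outDeg u := by exact_mod_cast hc
    have hsum : ((cdist (Fintype.card V) (τ u) (τ z) : ℕ) : ℝ) / (Fintype.card V : ℝ)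
        + δ / (Fintype.card V : ℝ) < len u := by
      rw [← add_div, div_lt_div_iff_of_pos_right hn]
      linarith [eps_ge (τ u)]
    have hd0 : 0 < δ / (Fintype.card V : ℝ) := by positivity
    have hc0 : 0 ≤ ((cdist (Fintype.card V) (τ u) (τ z) : ℕ) : ℝ) / (Fintype.card V : ℝ) := by
      positivity
    rw [mem_pts]
    change 0 < fd (pt (τ u)) _ ∧ fd (pt (τ u)) _ < fd (pt (τ u)) (pt (τ u) + (len u : Circ))
    rw [hlen]
    have h0 := fd_nonneg (pt (τ u)) (pt (τ z) + ((δ / (Fintype.card V : ℝ) : ℝ) : Circ))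
    have hl1 := len_lt u
    rcases fd_coc (pt (τ u)) (pt (τ z)) (pt (τ z) + ((δ / (Fintype.card V : ℝ) : ℝ) : Circ))
      with e | e
    · rw [hp, fd_pt] at e
      constructor <;> linarith
    · rw [hp, fd_pt] at e
      linarith
  · intro u v
    constructor
    · intro ha
      refine ⟨ha.ne, ?_⟩
      by_cases hd : D.dir u v
      · exact start_inter ((hmem u v).mpr hd) (start_ne_end M v)
      · have hd' : D.dir v u := (D.adj_dir v u ha.symm).mpr hd
        exact inter_comm' M (start_inter ((hmem v u).mpr hd') (start_ne_end M u))
    · rintro ⟨hne, hi⟩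
      rcases hinter u v hne hi with hd | hd
      · exact D.dir_adj _ _ hd
      · exact (D.dir_adj _ _ hd).symm
end

/-- A graph is an NHCA graph iff it admits a locally out-straight
orientation. -/
theorem stmt_18 {V : Type} [Fintype V] (G : SimpleGraph V) :
    IsNHCAGraph G ↔
      ∃ (D : GraphOrientation G) (σ : Fin (Fintype.card V) ≃ V),
        IsLocallyOutStraightEnum D σ := by
  constructor
  · intro h
    obtain ⟨D, σ, h1, h2⟩ := forward h
    exact ⟨D, σ, straight_of h1 h2⟩
  · rintro ⟨D, σ, h⟩
    exact backward h.1 (of_straight h).2
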